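/- Let F be a differential field with constants K, and suppose M ∈ F^{n×n} satisfies M M' = M' M. Then there is an invertible matrix T ∈ K^{n×n} such that T⁻¹ M T = diag(M₁,…,M_k) is block diagonal, where the minimal polynomial of each block M_i is a power of a polynomial irreducible over F. -/

import Mathlib

def IsDeriv {F : Type*} [Field F] (d : F → F) : Prop :=
  (∀ a b, d (a + b) = d a + d b) ∧ (∀ a b, d (a * b) = d a * b + a * d b)

open Polynomial in
/-- Pairwise coprime polynomials whose product annihilates `x` give rise to complete orthogonal
idempotents that are polynomials in `x`. -/
theorem exists_completeOrthogonalIdempotents_aeval {F A ι : Type*} [Field F] [Ring A] [Algebra F A]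
    [Fintype ι] (x : A) (q : ι → F[X]) (hq : Pairwise (Function.onFun IsCoprime q))
    (hx : aeval x (∏ i, q i) = 0) :
    ∃ g : ι → F[X], CompleteOrthogonalIdempotents (fun i => aeval x (g i)) ∧
      ∀ i, aeval x (q i) * aeval x (g i) = 0 := by
  classical
  rcases isEmpty_or_nonempty ι with h | h
  · refine ⟨fun _ => 0, CompleteOrthogonalIdempotents.iff_ortho_complete.2
      ⟨fun i => h.elim i, ?_⟩, fun i => h.elim i⟩
    simpa using hx.symm
  · obtain ⟨u, hu⟩ := exists_sum_eq_one_iff_pairwise_coprime'.2 hq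
    have hzero (i : ι) : aeval x (q i) * aeval x (u i * ∏ j ∈ {i}ᶜ, q j) = 0 := by
      rw [← map_mul, mul_left_comm, ← Fintype.prod_eq_mul_prod_compl, map_mul, hx, mul_zero]
    refine ⟨fun i => u i * ∏ j ∈ {i}ᶜ, q j, CompleteOrthogonalIdempotents.iff_ortho_complete.2
      ⟨fun i j hij => ?_, ?_⟩, hzero⟩
    · have hdvd : q j ∣ u i * ∏ l ∈ {i}ᶜ, q l :=
        Dvd.dvd.mul_left (Finset.dvd_prod_of_mem _ (by simpa using hij.symm)) _
      obtain ⟨r, hr⟩ := hdvd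
      change aeval x (u i * ∏ l ∈ {i}ᶜ, q l) * aeval x (u j * ∏ l ∈ {j}ᶜ, q l) = 0
      rw [← map_mul, hr, mul_right_comm, map_mul, map_mul (aeval x) (q j), hzero, zero_mul]
    · rw [← map_sum, hu, map_one]

open scoped Matrix in
open scoped Matrix in
open scoped Matrix in
/-- The range decomposition of complete orthogonal idempotent matrices, in matrix form. -/
theorem CompleteOrthogonalIdempotents.exists_isUnit_mul_diagonal {K ι : Type*} [Field K]
    [Fintype ι] [DecidableEq ι] {n : ℕ} {E : ι → Matrix (Fin n) (Fin n) K}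
    (hE : CompleteOrthogonalIdempotents E) :
    ∃ (sz : ι → ℕ) (e : (Σ i, Fin (sz i)) ≃ Fin n) (T : Matrix (Fin n) (Fin n) K),
      IsUnit T ∧
        ∀ i, E i * T = T * Matrix.diagonal (fun q => if (e.symm q).1 = i then 1 else 0) := by
  let V (i : ι) : Submodule K (Fin n → K) := LinearMap.range (E i).mulVecLin
  have hfix {i : ι} {v : Fin n → K} (hv : v ∈ V i) : E i *ᵥ v = v := by
    obtain ⟨w, rfl⟩ := hv
    simp [Matrix.mulVec_mulVec, (hE.idem i).eq]
  have hkill {i j : ι} (hij : i ≠ j) {v : Fin n → K} (hv : v ∈ V j) : E i *ᵥ v = 0 := by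
    obtain ⟨w, rfl⟩ := hv
    simp [Matrix.mulVec_mulVec, hE.ortho hij]
  let φ : (Fin n → K) ≃ₗ[K] (∀ i, V i) := LinearEquiv.ofLinearMap
    (LinearMap.pi fun i => (E i).mulVecLin.rangeRestrict)
    (∑ i, (V i).subtype ∘ₗ LinearMap.proj i)
    (by
      refine LinearMap.ext fun v => funext fun i => Subtype.ext ?_
      simp only [LinearMap.comp_apply, LinearMap.sum_apply, LinearMap.proj_apply,
        LinearMap.pi_apply, LinearMap.codRestrict_apply, LinearMap.rangeRestrict,
        Submodule.subtype_apply, Matrix.mulVecLin_apply, LinearMap.id_apply, Matrix.mulVec_sum]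
      rw [Finset.sum_eq_single i (fun j _ hj => hkill hj.symm (v j).2) (by simp)]
      exact hfix (v i).2)
    (by
      refine LinearMap.ext fun v => ?_
      simp only [LinearMap.comp_apply, LinearMap.sum_apply, LinearMap.proj_apply,
        LinearMap.pi_apply, LinearMap.codRestrict_apply, LinearMap.rangeRestrict,
        Submodule.subtype_apply, Matrix.mulVecLin_apply, LinearMap.id_apply]
      rw [← Matrix.sum_mulVec, hE.complete, Matrix.one_mulVec])
  let b := (Pi.basis fun i => Module.finBasis K (V i)).map φ.symm
  have hb (s) : b s ∈ V s.1 := by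
    have : b s = Module.finBasis K (V s.1) s.2 := by
      simp only [b, Module.Basis.map_apply, Pi.basis_apply]
      simp [φ, LinearMap.sum_apply]
      rw [Finset.sum_eq_single s.1 (fun j _ hj => by simp [Pi.single_eq_of_ne hj]) (by simp)]
      simp
    rw [this]
    exact Subtype.prop _
  let e := b.indexEquiv (Pi.basisFun K (Fin n))
  refine ⟨fun i => Module.finrank K (V i), e,
    (Pi.basisFun K (Fin n)).toMatrix (b.reindex e), ?_, fun i => ?_⟩
  · exact ⟨⟨_, _, Module.Basis.toMatrix_mul_toMatrix_flip _ _,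
      Module.Basis.toMatrix_mul_toMatrix_flip _ _⟩, rfl⟩
  · ext p q
    have hcol : (E i * (Pi.basisFun K (Fin n)).toMatrix (b.reindex e)) p q =
        (E i *ᵥ b (e.symm q)) p := by
      simp [Matrix.mul_apply, Matrix.mulVec, dotProduct, Module.Basis.toMatrix_apply]
    rw [hcol, Matrix.mul_diagonal, Module.Basis.toMatrix_apply]
    by_cases h : (e.symm q).1 = i
    · rw [hfix (h ▸ hb _)]
      simp [h]
    · rw [hkill (Ne.symm h) (hb _)]
      simp [h]

namespace IsDeriv

variable {F : Type*} [Field F] {d : F → F}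

theorem map_zero (hd : IsDeriv d) : d 0 = 0 := by
  simpa using hd.1 0 0

theorem map_one (hd : IsDeriv d) : d 1 = 0 := by
  simpa using hd.2 1 1

theorem map_neg (hd : IsDeriv d) (a : F) : d (-a) = -d a :=
  (AddMonoidHom.mk' d hd.1).map_neg a

theorem map_sum (hd : IsDeriv d) {ι : Type*} (s : Finset ι) (f : ι → F) :
    d (∑ i ∈ s, f i) = ∑ i ∈ s, d (f i) :=
  _root_.map_sum (AddMonoidHom.mk' d hd.1) f s

/-- The field of constants of a derivation. -/
def constants (hd : IsDeriv d) : Subfield F where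
  carrier := {x | d x = 0}
  zero_mem' := hd.map_zero
  one_mem' := hd.map_one
  add_mem' {a b} ha hb := by
    simp only [Set.mem_ofPred_eq] at *
    rw [hd.1, ha, hb, add_zero]
  mul_mem' {a b} ha hb := by
    simp only [Set.mem_ofPred_eq] at *
    rw [hd.2, ha, hb, zero_mul, mul_zero, add_zero]
  neg_mem' {a} ha := by
    simp only [Set.mem_ofPred_eq] at *
    rw [hd.map_neg, ha, neg_zero]
  inv_mem' a ha := by
    simp only [Set.mem_ofPred_eq] at *
    rcases eq_or_ne a 0 with rfl | h
    · simpa using ha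
    · have h1 := hd.2 a a⁻¹
      rw [mul_inv_cancel₀ h, hd.map_one, ha, zero_mul, zero_add] at h1
      exact (mul_eq_zero.1 h1.symm).resolve_left h

theorem mem_constants (hd : IsDeriv d) {x : F} : x ∈ hd.constants ↔ d x = 0 :=
  Iff.rfl

theorem matrix_map_mul {m : Type*} [Fintype m] (hd : IsDeriv d) (A B : Matrix m m F) :
    (A * B).map d = A.map d * B + A * B.map d := by
  ext p q
  simp [Matrix.mul_apply, hd.map_sum, hd.2, Finset.sum_add_distrib]

theorem matrix_map_add {m : Type*} (hd : IsDeriv d) (A B : Matrix m m F) :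
    (A + B).map d = A.map d + B.map d := by
  ext p q
  simp [hd.1]

theorem matrix_map_algebraMap {m : Type*} [Fintype m] [DecidableEq m]
    (hd : IsDeriv d) (a : F) :
    (algebraMap F (Matrix m m F) a).map d = algebraMap F (Matrix m m F) (d a) := by
  ext p q
  by_cases h : p = q <;> simp [Matrix.algebraMap_matrix_apply, h, hd.map_zero]

open Polynomial in
/-- If `M` commutes with its derivative, then polynomials in `M` commute with derivatives of
polynomials in `M`. -/
theorem commute_aeval_map_aeval {m : Type*} [Fintype m] [DecidableEq m]
    (hd : IsDeriv d) {M : Matrix m m F}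
    (hM : Commute M (M.map d)) (f g : F[X]) :
    Commute (aeval M g) ((aeval M f).map d) := by
  have hgM : Commute (aeval M g) (M.map d) := by
    induction g using Polynomial.induction_on' with
    | add p q hp hq => simpa using hp.add_left hq
    | monomial n a =>
      rw [aeval_monomial]
      exact (Algebra.commute_algebraMap_left _ _).mul_left (hM.pow_left n)
  have hgg (p : F[X]) : Commute (aeval M g) (aeval M p) := by
    rw [commute_iff_eq, ← map_mul, ← map_mul, mul_comm]
  induction f using Polynomial.induction_on with
  | C a =>
    rw [aeval_C, hd.matrix_map_algebraMap]
    exact Algebra.commute_algebraMap_right _ _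
  | add p q hp hq =>
    rw [map_add, hd.matrix_map_add]
    exact hp.add_right hq
  | monomial n a ih =>
    rw [pow_succ, ← mul_assoc, map_mul, aeval_X, hd.matrix_map_mul]
    refine (ih.mul_right ?_).add_right ((hgg _).mul_right hgM)
    simpa using hgg X

/-- An idempotent matrix that commutes with its derivative has constant entries. -/
theorem map_eq_zero_of_isIdempotentElem {m : Type*} [Fintype m]
    (hd : IsDeriv d) {E : Matrix m m F}
    (hE : IsIdempotentElem E) (hc : Commute E (E.map d)) : E.map d = 0 := by
  have h : E.map d = E * E.map d + E * E.map d := by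
    conv_lhs => rw [← hE.eq, hd.matrix_map_mul, ← hc.eq]
  have h' : E * E.map d = E * E.map d + E * E.map d := by
    conv_lhs => rw [h, mul_add, ← mul_assoc, hE.eq]
  have h0 : E * E.map d = 0 := by simpa using h'
  rw [h, h0, add_zero]

end IsDeriv

open Polynomial in
theorem Matrix.aeval_blockDiagonal' {F o : Type*} [Field F] [Fintype o] [DecidableEq o]
    {m : o → Type*} [∀ i, Fintype (m i)] [∀ i, DecidableEq (m i)]
    (B : ∀ i, Matrix (m i) (m i) F) (f : F[X]) :
    aeval (Matrix.blockDiagonal' B) f = Matrix.blockDiagonal' fun i => aeval (B i) f := by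
  induction f using Polynomial.induction_on' with
  | add p q hp hq =>
    simp only [map_add, hp, hq, ← Matrix.blockDiagonal'_add]
    rfl
  | monomial n a =>
    simp only [aeval_monomial, ← Algebra.smul_def, ← Matrix.blockDiagonal'_pow,
      ← Matrix.blockDiagonal'_smul]
    rfl

open Polynomial UniqueFactorizationMonoid in
/-- A monic polynomial is a product of powers of pairwise coprime monic irreducibles. -/
theorem Polynomial.Monic.exists_prod_pow_irreducible {F : Type*} [Field F] {f : F[X]}
    (hf : f.Monic) :
    ∃ (k : ℕ) (p : Fin k → F[X]) (r : Fin k → ℕ), (∀ i, Irreducible (p i)) ∧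
      (∀ i, (p i).Monic) ∧ Pairwise (Function.onFun IsCoprime fun i => p i ^ r i) ∧
      f = ∏ i, p i ^ r i := by
  classical
  let s := (normalizedFactors f).toFinset
  have hmem (i : Fin s.card) : (s.equivFin.symm i : F[X]) ∈ normalizedFactors f :=
    Multiset.mem_toFinset.1 (s.equivFin.symm i).2
  have hirr (i : Fin s.card) : Irreducible (s.equivFin.symm i : F[X]) :=
    irreducible_of_normalized_factor _ (hmem i)
  have hmon (i : Fin s.card) : (s.equivFin.symm i : F[X]).Monic := by
    rw [← normalize_normalized_factor _ (hmem i)]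
    exact monic_normalize (hirr i).ne_zero
  refine ⟨s.card, fun i => s.equivFin.symm i,
    fun i => (normalizedFactors f).count (s.equivFin.symm i : F[X]), hirr, hmon,
    fun i j hij => IsCoprime.pow ?_, ?_⟩
  · refine ((hirr i).coprime_iff_not_dvd).2 fun hdvd => hij ?_
    exact s.equivFin.symm.injective (Subtype.ext (eq_of_monic_of_associated (hmon i) (hmon j)
      ((hirr i).associated_of_dvd (hirr j) hdvd)))
  · have h1 : f = (normalizedFactors f).prod := by
      rw [prod_normalizedFactors_eq hf.ne_zero, hf.normalize_eq_self]
    rw [Equiv.prod_comp s.equivFin.symm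
      fun x : s => (x : F[X]) ^ (normalizedFactors f).count (x : F[X])]
    rw [Finset.prod_coe_sort s fun x : F[X] => x ^ (normalizedFactors f).count x,
      ← Finset.prod_multiset_count]
    exact h1

/-- If `M M' = M' M`, then some invertible matrix `T` with constant entries
brings `M` to block diagonal form, where the minimal polynomial of each block is
a power of a polynomial irreducible over `F`. -/
theorem constant_block_diagonal_decomposition {F : Type*} [Field F]
    (d : F → F) (hd : IsDeriv d)
    {n : ℕ} (M : Matrix (Fin n) (Fin n) F)
    (hcomm : M * M.map d = M.map d * M) :
    ∃ (T : Matrix (Fin n) (Fin n) F), IsUnit T ∧ (∀ p q, d (T p q) = 0) ∧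
      ∃ (k : ℕ) (sz : Fin k → ℕ) (e : (Σ i : Fin k, Fin (sz i)) ≃ Fin n)
        (B : ∀ i : Fin k, Matrix (Fin (sz i)) (Fin (sz i)) F),
        T⁻¹ * M * T = (Matrix.blockDiagonal' B).submatrix e.symm e.symm ∧
        ∀ i : Fin k, ∃ (p : Polynomial F) (m : ℕ),
          Irreducible p ∧ minpoly F (B i) = p ^ m := by
  classical
  obtain ⟨k, p, r, hirr, hmon, hcop, hprod⟩ :=
    (minpoly.monic (Algebra.IsIntegral.isIntegral (R := F) M)).exists_prod_pow_irreducible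
  obtain ⟨g, hE, hqE⟩ := exists_completeOrthogonalIdempotents_aeval M _ hcop
    (by rw [← hprod, minpoly.aeval])
  have hconst (i : Fin k) : (Polynomial.aeval M (g i)).map d = 0 :=
    hd.map_eq_zero_of_isIdempotentElem (hE.idem i)
      (hd.commute_aeval_map_aeval hcomm _ _)
  let ψ : Matrix (Fin n) (Fin n) hd.constants →+* Matrix (Fin n) (Fin n) F :=
    hd.constants.subtype.mapMatrix
  have hψ : Function.Injective ψ := Matrix.map_injective Subtype.val_injective
  let E (i : Fin k) : Matrix (Fin n) (Fin n) hd.constants :=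
    fun a b => ⟨Polynomial.aeval M (g i) a b, congrFun (congrFun (hconst i) a) b⟩
  have hψE (i : Fin k) : ψ (E i) = Polynomial.aeval M (g i) := rfl
  have hE' : CompleteOrthogonalIdempotents E := by
    refine CompleteOrthogonalIdempotents.iff_ortho_complete.2 ⟨fun i j hij => hψ ?_, hψ ?_⟩
    · rw [map_mul, map_zero, hψE, hψE]
      exact hE.ortho hij
    · rw [map_sum, map_one]
      exact hE.complete
  obtain ⟨sz, e, T, hT, hET⟩ := hE'.exists_isUnit_mul_diagonal
  have hU : IsUnit (ψ T) := hT.map ψ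
  have hdet : IsUnit (ψ T).det := (Matrix.isUnit_iff_isUnit_det _).1 hU
  let D (i : Fin k) : Matrix (Fin n) (Fin n) F :=
    Matrix.diagonal (fun q => if (e.symm q).1 = i then 1 else 0)
  have hD (i : Fin k) : Polynomial.aeval M (g i) * ψ T = ψ T * D i := by
    have h := congrArg ψ (hET i)
    rw [map_mul, map_mul, hψE] at h
    rw [h]
    congr 1
    ext a b
    by_cases hab : a = b
    · subst hab
      by_cases h' : (e.symm a).1 = i <;> simp [ψ, D, h']
    · simp [ψ, D, hab]
  let N := (ψ T)⁻¹ * M * ψ T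
  have hTN : M * ψ T = ψ T * N := by
    simp only [N, ← mul_assoc, Matrix.mul_nonsing_inv _ hdet, one_mul]
  have hTf (f : Polynomial F) :
      Polynomial.aeval M f * ψ T = ψ T * Polynomial.aeval N f := by
    induction f using Polynomial.induction_on with
    | C a => simpa using Algebra.commutes a (ψ T)
    | add f₁ f₂ h₁ h₂ => rw [map_add, map_add, add_mul, mul_add, h₁, h₂]
    | monomial n a ih =>
      rw [pow_succ, ← mul_assoc, map_mul, map_mul _ _ Polynomial.X, Polynomial.aeval_X,
        Polynomial.aeval_X, mul_assoc, hTN, ← mul_assoc, ih, mul_assoc]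
  have hND (i : Fin k) : N * D i = D i * N := by
    have hc : M * Polynomial.aeval M (g i) = Polynomial.aeval M (g i) * M := by
      simpa using congrArg (Polynomial.aeval M) (mul_comm Polynomial.X (g i))
    apply hU.mul_left_cancel
    rw [← mul_assoc, ← hTN, mul_assoc, ← hD, ← mul_assoc, ← mul_assoc, ← hD, mul_assoc _ (ψ T),
      ← hTN, ← mul_assoc, hc]
  have hoff {a b : Fin n} (hab : (e.symm a).1 ≠ (e.symm b).1) : N a b = 0 := by
    have h := congrFun (congrFun (hND (e.symm b).1) a) b
    simpa [D, Matrix.mul_diagonal, Matrix.diagonal_mul, hab] using h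
  let B (i : Fin k) : Matrix (Fin (sz i)) (Fin (sz i)) F :=
    fun a b => N (e ⟨i, a⟩) (e ⟨i, b⟩)
  have hNB : N = (Matrix.blockDiagonal' B).submatrix e.symm e.symm := by
    ext a b
    obtain ⟨⟨i, a⟩, rfl⟩ := e.surjective a
    obtain ⟨⟨j, b⟩, rfl⟩ := e.surjective b
    by_cases hij : i = j
    · subst hij
      simp only [Matrix.submatrix_apply, Equiv.symm_apply_apply, Matrix.blockDiagonal'_apply_eq]
      rfl
    · rw [hoff (by simpa using hij)]
      simp [Matrix.blockDiagonal'_apply, hij]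
  have hNf (f : Polynomial F) : Polynomial.aeval N f =
      (Matrix.blockDiagonal' fun i => Polynomial.aeval (B i) f).submatrix e.symm e.symm := by
    have h := Polynomial.aeval_algHom_apply (Matrix.reindexAlgEquiv F F e).toAlgHom
      (Matrix.blockDiagonal' B) f
    rw [Matrix.aeval_blockDiagonal'] at h
    rw [hNB]
    exact h
  refine ⟨ψ T, hU, fun a b => (T a b).2, k, sz, e, B, hNB, fun i => ⟨p i, ?_⟩⟩
  have hBi : Polynomial.aeval (B i) (p i ^ r i) = 0 := by
    have h : Polynomial.aeval N (p i ^ r i) * D i = 0 := by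
      apply hU.mul_left_cancel
      rw [← mul_assoc, ← hTf, mul_assoc, ← hD, ← mul_assoc, hqE, zero_mul, mul_zero]
    ext a b
    have h' := congrFun (congrFun h (e ⟨i, a⟩)) (e ⟨i, b⟩)
    rw [hNf] at h'
    simpa [D, Matrix.mul_diagonal, Matrix.blockDiagonal'_apply] using h'
  obtain ⟨j, -, hj⟩ := (dvd_prime_pow (hirr i).prime _).1 (minpoly.dvd F (B i) hBi)
  exact ⟨j, hirr i, Polynomial.eq_of_monic_of_associated
    (minpoly.monic (Algebra.IsIntegral.isIntegral _)) ((hmon i).pow j) hj⟩
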